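/- For every real λ > 0 and every real x with 0 < x ≤ λ, the lower tail of the Poisson distribution satisfies ∑_{n ∈ ℕ, n ≤ x} e^{-λ} λ^n / n! ≤ e^{-λ} (eλ/x)^x. -/

import Mathlib

/-- Chernoff-type lower tail bound for the Poisson distribution:
for `λ > 0` and `0 < x ≤ λ`, `Pr[Pois(λ) ≤ x] ≤ e^{-λ} (eλ/x)^x`. -/
theorem poisson_lower_tail_chernoff (lam x : ℝ) (hlam : 0 < lam)
    (hx0 : 0 < x) (hx : x ≤ lam) :
    (∑' n : ℕ, if (n : ℝ) ≤ x
        then Real.exp (-lam) * lam ^ n / (Nat.factorial n : ℝ) else 0)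
      ≤ Real.exp (-lam) * (Real.exp 1 * lam / x) ^ x := by
  have hs : HasSum (fun n : ℕ => x ^ n / (Nat.factorial n : ℝ)) (Real.exp x) := by
    rw [Real.exp_eq_exp_ℝ]
    exact NormedSpace.expSeries_div_hasSum_exp x
  have hs2 := hs.mul_left (Real.exp (-lam) * (lam / x) ^ x)
  have hR : Real.exp (-lam) * (Real.exp 1 * lam / x) ^ x
      = Real.exp (-lam) * (lam / x) ^ x * Real.exp x := by
    rw [mul_div_assoc, Real.mul_rpow (Real.exp_pos 1).le (by positivity), Real.exp_one_rpow]
    ring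
  have hle : ∀ n : ℕ, (if (n : ℝ) ≤ x
        then Real.exp (-lam) * lam ^ n / (Nat.factorial n : ℝ) else 0)
      ≤ Real.exp (-lam) * (lam / x) ^ x * (x ^ n / (Nat.factorial n : ℝ)) := by
    intro n
    split_ifs with h
    · have h1 : (lam / x) ^ n ≤ (lam / x) ^ x := by
        rw [← Real.rpow_natCast]
        exact Real.rpow_le_rpow_of_exponent_le ((one_le_div hx0).2 hx) h
      have h2 : lam ^ n = (lam / x) ^ n * x ^ n := by
        rw [← mul_pow, div_mul_cancel₀ _ hx0.ne']
      calc Real.exp (-lam) * lam ^ n / (Nat.factorial n : ℝ)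
          = Real.exp (-lam) * (lam / x) ^ n * (x ^ n / (Nat.factorial n : ℝ)) := by
            rw [h2]; ring
        _ ≤ _ := by gcongr
    · positivity
  have hsum : Summable (fun n : ℕ => if (n : ℝ) ≤ x
        then Real.exp (-lam) * lam ^ n / (Nat.factorial n : ℝ) else 0) := by
    refine Summable.of_nonneg_of_le (fun n => ?_) hle hs2.summable
    split_ifs <;> positivity
  rw [hR, ← hs2.tsum_eq]
  exact hsum.tsum_le_tsum hle hs2.summable
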